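/- API(α): let (π_i)_{i≥0} be a CPI-type sequence with constant step α_i = α ∈ (0,1], but suppose the errors are controlled directly by ν: ν e_i ≤ ε for all i ≥ 1, where ε ∈ (0, 2Vmax], and assume C^{(1,0)} := (1−γ)Σ_{l≥0}γ^l c(l) < ∞. If k = ⌈log(2Vmax/ε)/(α(1−γ))⌉, then μ(v_{π*} − v_{π_k}) ≤ (αk C^{(1,0)}/(1−γ) + 1) ε ≤ (C^{(1,0)}(log(2Vmax/ε)/(1−γ) + 1)/(1−γ) + 1) ε. -/

import Mathlib

open Finset Matrix

noncomputable section

/-- Transition matrix of a deterministic stationary policy. -/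
def polMat {S A : Type*} (P : S → A → S → ℝ) (π : S → A) : Matrix S S ℝ :=
  Matrix.of fun s s' => P s (π s) s'

/-- Bellman operator `T_π v = r + γ P_π v` of a deterministic stationary policy. -/
def bOp {S A : Type*} [Fintype S] (P : S → A → S → ℝ) (γ : ℝ) (r : S → ℝ)
    (π : S → A) (v : S → ℝ) : S → ℝ :=
  fun s => r s + γ * ∑ s' : S, P s (π s) s' * v s'

/-- `errOf P γ r v π = max_{π'} T_{π'} v − T_π v` (componentwise maximum over all
deterministic stationary policies `π'`). -/
def errOf {S A : Type*} [Fintype S] [Fintype A] [DecidableEq S] [Nonempty A]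
    (P : S → A → S → ℝ) (γ : ℝ) (r : S → ℝ) (v : S → ℝ) (π : S → A) : S → ℝ :=
  fun s => (Finset.univ.sup' Finset.univ_nonempty fun π' : S → A => bOp P γ r π' v s)
    - bOp P γ r π v s

/-- Values of the PSDP∞ non-stationary policies: `vSig P γ r πseq k = v_{σ_k}
= T_{π_k} T_{π_{k-1}} ⋯ T_{π_1} r` (so `vSig P γ r πseq 0 = r`). -/
def vSig {S A : Type*} [Fintype S] (P : S → A → S → ℝ) (γ : ℝ) (r : S → ℝ)
    (πseq : ℕ → S → A) : ℕ → S → ℝ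
  | 0 => r
  | k+1 => bOp P γ r (πseq (k+1)) (vSig P γ r πseq k)


/-- Transition matrix of a stochastic stationary policy:
`P_π(s,s') = Σ_a π(a|s) P(s'|s,a)`. -/
def polMatS {S A : Type*} [Fintype A] (P : S → A → S → ℝ) (π : S → A → ℝ) :
    Matrix S S ℝ :=
  Matrix.of fun s s' => ∑ a : A, π s a * P s a s'

/-- Bellman operator of a stochastic stationary policy. -/
def bOpS {S A : Type*} [Fintype S] [Fintype A] (P : S → A → S → ℝ) (γ : ℝ) (r : S → ℝ)
    (π : S → A → ℝ) (v : S → ℝ) : S → ℝ :=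
  fun s => r s + γ * ∑ s' : S, (∑ a : A, π s a * P s a s') * v s'

/-- A deterministic policy viewed as a stochastic one. -/
def detPol {S A : Type*} [DecidableEq A] (π : S → A) : S → A → ℝ :=
  fun s a => if a = π s then 1 else 0

/-- Per-state mixture `(1−α)π + απ'` of two stochastic policies. -/
def mixPol {S A : Type*} (α : ℝ) (π π' : S → A → ℝ) : S → A → ℝ :=
  fun s a => (1 - α) * π s a + α * π' s a

/-- `π` is a stochastic stationary policy. -/
def isStoch {S A : Type*} [Fintype A] (π : S → A → ℝ) : Prop :=
  (∀ s a, 0 ≤ π s a) ∧ ∀ s, ∑ a : A, π s a = 1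

/-- The CPI sequence `π_0`, `π_i = (1−α_i)π_{i−1} + α_i π'_i`. -/
def cpiSeq {S A : Type*} [DecidableEq A] (π0 : S → A → ℝ) (αf : ℕ → ℝ)
    (π'f : ℕ → S → A) : ℕ → S → A → ℝ
  | 0 => π0
  | i+1 => mixPol (αf (i+1)) (cpiSeq π0 αf π'f i) (detPol (π'f (i+1)))

open Filter in
/-- Unrolling `x n ≤ b n + γ x (n + 1)` for a bounded sequence whose increments are dominated
by a shifted summable sequence. -/
theorem pow_mul_le_tsum_mul_of_le_add_mul {γ B W : ℝ} (hγ0 : 0 < γ) (hγ1 : γ < 1) {c : ℕ → ℝ}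
    (hc0 : ∀ i, 0 ≤ c i) (hsum : Summable fun l : ℕ => γ ^ l * c l) (j : ℕ) {x b : ℕ → ℝ}
    (hB : 0 ≤ B) (hb : ∀ l, b l ≤ c (j + l) * B) (hx : ∀ n, x n ≤ b n + γ * x (n + 1))
    (hW : ∀ n, x n ≤ W) : γ ^ j * x 0 ≤ (∑' l : ℕ, γ ^ l * c l) * B := by
  have hunroll : ∀ N, x 0 ≤ (∑ l ∈ range N, γ ^ l * b l) + γ ^ N * x N := by
    intro N
    induction N with
    | zero => simp
    | succ N ih =>
      rw [sum_range_succ]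
      have := mul_le_mul_of_nonneg_left (hx N) (pow_pos hγ0 N).le
      rw [pow_succ]
      linarith
  have hpartial : ∀ N, (∑ l ∈ range N, γ ^ (j + l) * c (j + l)) ≤ ∑' l : ℕ, γ ^ l * c l := by
    intro N
    have hnn : ∀ l, 0 ≤ γ ^ l * c l := fun l => mul_nonneg (pow_pos hγ0 l).le (hc0 l)
    refine le_trans ?_ (hsum.sum_le_tsum (range (j + N)) fun l _ => hnn l)
    rw [sum_range_add]
    exact le_add_of_nonneg_left (sum_nonneg fun l _ => hnn l)
  have hbound : ∀ N, γ ^ j * x 0 ≤ (∑' l : ℕ, γ ^ l * c l) * B + γ ^ j * (γ ^ N * W) := by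
    intro N
    have hj := (pow_pos hγ0 j).le
    have h1 : γ ^ j * ∑ l ∈ range N, γ ^ l * b l
        ≤ (∑ l ∈ range N, γ ^ (j + l) * c (j + l)) * B := by
      rw [mul_sum, sum_mul]
      refine sum_le_sum fun l _ => ?_
      have := mul_le_mul_of_nonneg_left (hb l) (pow_pos hγ0 (j + l)).le
      rw [pow_add] at this ⊢
      linarith
    have h2 := mul_le_mul_of_nonneg_right (hpartial N) hB
    have h3 := mul_le_mul_of_nonneg_left (hunroll N) hj
    have h4 := mul_le_mul_of_nonneg_left
      (mul_le_mul_of_nonneg_left (hW N) (pow_pos hγ0 N).le) hj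
    linarith
  refine ge_of_tendsto' (x := atTop) ?_ hbound
  have ht := tendsto_pow_atTop_nhds_zero_of_lt_one hγ0.le hγ1
  simpa using ((ht.mul_const W).const_mul (γ ^ j)).const_add ((∑' l : ℕ, γ ^ l * c l) * B)

theorem Matrix.mulVec_le_mulVec_of_nonneg {S : Type*} [Fintype S] {M : Matrix S S ℝ}
    (hM : ∀ s s', 0 ≤ M s s') {f g : S → ℝ} (h : f ≤ g) : M *ᵥ f ≤ M *ᵥ g :=
  fun s => dotProduct_le_dotProduct_of_nonneg_left h (hM s)

theorem Matrix.mulVec_le_of_mem_rowStochastic {S : Type*} [Fintype S] [DecidableEq S]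
    {M : Matrix S S ℝ} (hM : M ∈ rowStochastic ℝ S) {f : S → ℝ} {W : ℝ} (h : ∀ s, f s ≤ W)
    (s : S) : (M *ᵥ f) s ≤ W := by
  calc (M *ᵥ f) s ≤ ∑ s', M s s' * W :=
        sum_le_sum fun s' _ => mul_le_mul_of_nonneg_left (h s') (hM.1 s s')
    _ = W := by rw [← sum_mul, sum_row_of_mem_rowStochastic hM, one_mul]

theorem dotProduct_le_of_sum_eq_one {S : Type*} [Fintype S] {μ f : S → ℝ} {W : ℝ}
    (hμ0 : ∀ s, 0 ≤ μ s) (hμ1 : ∑ s, μ s = 1) (h : ∀ s, f s ≤ W) : μ ⬝ᵥ f ≤ W := by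
  calc μ ⬝ᵥ f ≤ ∑ s, μ s * W := sum_le_sum fun s _ => mul_le_mul_of_nonneg_left (h s) (hμ0 s)
    _ = W := by rw [← sum_mul, hμ1, one_mul]

theorem isStoch_detPol {S A : Type*} [Fintype A] [DecidableEq A] (π : S → A) :
    isStoch (detPol π) :=
  ⟨fun s a => by unfold detPol; split_ifs <;> norm_num, fun s => by simp [detPol]⟩

theorem isStoch.mixPol {S A : Type*} [Fintype A] {α : ℝ} (hα0 : 0 ≤ α) (hα1 : α ≤ 1)
    {π π' : S → A → ℝ} (h : isStoch π) (h' : isStoch π') : isStoch (mixPol α π π') :=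
  ⟨fun s a => add_nonneg (mul_nonneg (sub_nonneg.2 hα1) (h.1 s a)) (mul_nonneg hα0 (h'.1 s a)),
    fun s => by simp [_root_.mixPol, sum_add_distrib, ← mul_sum, h.2 s, h'.2 s]⟩

theorem isStoch_cpiSeq {S A : Type*} [Fintype A] [DecidableEq A] {π0 : S → A → ℝ}
    (hπ0 : isStoch π0) {α : ℝ} (hα0 : 0 ≤ α) (hα1 : α ≤ 1) (π'f : ℕ → S → A) (i : ℕ) :
    isStoch (cpiSeq π0 (fun _ => α) π'f i) := by
  induction i with
  | zero => exact hπ0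
  | succ i ih => exact ih.mixPol hα0 hα1 (isStoch_detPol _)

section

variable {S A : Type*} {P : S → A → S → ℝ}

theorem polMatS_mem_rowStochastic [Fintype S] [Fintype A] [DecidableEq S]
    (hP0 : ∀ s a s', 0 ≤ P s a s')
    (hP1 : ∀ s a, ∑ s' : S, P s a s' = 1) {π : S → A → ℝ} (hπ : isStoch π) :
    polMatS P π ∈ rowStochastic ℝ S := by
  refine mem_rowStochastic_iff_sum.2
    ⟨fun s s' => sum_nonneg fun a _ => mul_nonneg (hπ.1 s a) (hP0 s a s'), fun s => ?_⟩
  simp only [polMatS, of_apply]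
  rw [sum_comm]
  simp [← mul_sum, hP1, hπ.2]

theorem polMatS_detPol [Fintype A] [DecidableEq A]
    (π : S → A) : polMatS P (detPol π) = polMat P π := by
  ext s s'
  simp [polMatS, polMat, detPol]

theorem polMat_mem_rowStochastic [Fintype S] [Fintype A] [DecidableEq S] [DecidableEq A]
    (hP0 : ∀ s a s', 0 ≤ P s a s')
    (hP1 : ∀ s a, ∑ s' : S, P s a s' = 1) (π : S → A) :
    polMat P π ∈ rowStochastic ℝ S :=
  polMatS_detPol (P := P) π ▸ polMatS_mem_rowStochastic hP0 hP1 (isStoch_detPol π)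

theorem polMatS_mixPol [Fintype A]
    (α : ℝ) (π π' : S → A → ℝ) :
    polMatS P (mixPol α π π') = (1 - α) • polMatS P π + α • polMatS P π' := by
  ext s s'
  simp [polMatS, mixPol, add_mul, sum_add_distrib, mul_sum, mul_assoc]

theorem bOp_apply [Fintype S]
    (γ : ℝ) (r : S → ℝ) (π : S → A) (v : S → ℝ) (s : S) :
    bOp P γ r π v s = r s + γ * (polMat P π *ᵥ v) s := rfl

theorem bOpS_apply [Fintype S] [Fintype A]
    (γ : ℝ) (r : S → ℝ) (π : S → A → ℝ) (v : S → ℝ) (s : S) :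
    bOpS P γ r π v s = r s + γ * (polMatS P π *ᵥ v) s := rfl

theorem polMatS_mulVec_apply [Fintype S] [Fintype A]
    (π : S → A → ℝ) (v : S → ℝ) (s : S) :
    (polMatS P π *ᵥ v) s = ∑ a, π s a * ∑ s', P s a s' * v s' := by
  simp only [polMatS, mulVec, dotProduct, of_apply, sum_mul, mul_sum]
  rw [sum_comm]
  simp [mul_assoc]

/-- A deterministic greedy policy dominates a stochastic one in a single transition. -/
theorem exists_polMatS_mulVec_le [Fintype S] [Fintype A]
    [Nonempty A] {π : S → A → ℝ} (hπ : isStoch π) (f : S → ℝ) :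
    ∃ π' : S → A, polMatS P π *ᵥ f ≤ polMat P π' *ᵥ f := by
  choose π' hπ' using fun s => Finite.exists_max fun a => ∑ s', P s a s' * f s'
  refine ⟨π', fun s => ?_⟩
  rw [polMatS_mulVec_apply]
  calc ∑ a, π s a * ∑ s', P s a s' * f s'
      ≤ ∑ a, π s a * ∑ s', P s (π' s) s' * f s' :=
        sum_le_sum fun a _ => mul_le_mul_of_nonneg_left (hπ' s a) (hπ.1 s a)
    _ = (polMat P π' *ᵥ f) s := by
        rw [← sum_mul, hπ.2, one_mul]
        rfl

/-- `g` is dominated by the image of `f` under a product of `n` deterministic policies. -/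
def DominatedBy [Fintype S] [DecidableEq S] (P : S → A → S → ℝ) (n : ℕ) (g f : S → ℝ) : Prop :=
  ∃ πs : ℕ → S → A, g ≤ ((List.range n).map fun t => polMat P (πs t)).prod *ᵥ f

theorem dominatedBy_zero [Fintype S] [DecidableEq S]
    [Nonempty A] (f : S → ℝ) : DominatedBy P 0 f f :=
  ⟨fun _ _ => Classical.arbitrary A, by simp⟩

theorem DominatedBy.polMatS_mulVec [Fintype S] [Fintype A] [DecidableEq S] [DecidableEq A]
    [Nonempty A] (hP0 : ∀ s a s', 0 ≤ P s a s')
    (hP1 : ∀ s a, ∑ s' : S, P s a s' = 1) {π : S → A → ℝ} (hπ : isStoch π) {n : ℕ}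
    {g f : S → ℝ} (h : DominatedBy P n g f) : DominatedBy P (n + 1) (polMatS P π *ᵥ g) f := by
  obtain ⟨πs, hs⟩ := h
  obtain ⟨π', hπ'⟩ := exists_polMatS_mulVec_le (P := P) hπ g
  refine ⟨fun t => Nat.casesOn t π' πs, hπ'.trans ?_⟩
  rw [List.range_succ_eq_map, List.map_cons, List.prod_cons, List.map_map, ← mulVec_mulVec]
  exact mulVec_le_mulVec_of_nonneg (polMat_mem_rowStochastic hP0 hP1 π').1 hs

theorem DominatedBy.polMatS_pow_mulVec [Fintype S] [Fintype A] [DecidableEq S] [DecidableEq A]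
    [Nonempty A] (hP0 : ∀ s a s', 0 ≤ P s a s')
    (hP1 : ∀ s a, ∑ s' : S, P s a s' = 1) {π : S → A → ℝ} (hπ : isStoch π) {n : ℕ}
    {g f : S → ℝ} (h : DominatedBy P n g f) (j : ℕ) :
    DominatedBy P (j + n) (polMatS P π ^ j *ᵥ g) f := by
  induction j with
  | zero => simpa using h
  | succ j ih =>
    rw [pow_succ', ← mulVec_mulVec, Nat.add_right_comm]
    exact ih.polMatS_mulVec hP0 hP1 hπ

theorem DominatedBy.dotProduct_le [Fintype S] [DecidableEq S]
    {μ ν : S → ℝ} (hμ0 : ∀ s, 0 ≤ μ s) {c : ℕ → ℝ}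
    (hc : ∀ (i : ℕ) (πs : ℕ → S → A) (s : S),
      Matrix.vecMul μ (((List.range i).map fun t => polMat P (πs t)).prod) s ≤ c i * ν s)
    {n : ℕ} {g f : S → ℝ} (hf : 0 ≤ f) (h : DominatedBy P n g f) :
    μ ⬝ᵥ g ≤ c n * (ν ⬝ᵥ f) := by
  obtain ⟨πs, hs⟩ := h
  refine (dotProduct_le_dotProduct_of_nonneg_left hs hμ0).trans ?_
  rw [dotProduct_mulVec, ← smul_eq_mul, ← smul_dotProduct]
  exact dotProduct_le_dotProduct_of_nonneg_right (hc n πs) hf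

/-- The value of a stochastic policy lies between `-Rmax / (1 - γ)` and `Rmax / (1 - γ)`. -/
theorem abs_le_of_eq_add_mul_mulVec [Fintype S] [DecidableEq S] [Nonempty S] {γ Rmax : ℝ} (hγ0 : 0 < γ) (hγ1 : γ < 1)
    {r : S → ℝ} (hr : ∀ s, |r s| ≤ Rmax) {M : Matrix S S ℝ} (hM : M ∈ rowStochastic ℝ S)
    {v : S → ℝ} (hv : ∀ s, r s + γ * (M *ᵥ v) s = v s) (s : S) :
    |v s| ≤ Rmax / (1 - γ) := by
  obtain ⟨t, ht⟩ := Finite.exists_max fun s => |v s|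
  refine (ht s).trans ?_
  rw [le_div_iff₀ (sub_pos.2 hγ1)]
  have h1 := mulVec_le_of_mem_rowStochastic hM (fun s => (abs_le.1 (ht s)).2) t
  have h2 := mulVec_le_of_mem_rowStochastic hM (f := -v)
    (fun s => (neg_le_abs (v s)).trans (ht s)) t
  rw [mulVec_neg, Pi.neg_apply] at h2
  have h3 : |v t| ≤ |r t| + γ * |(M *ᵥ v) t| := by
    conv_lhs => rw [← hv t]
    refine (abs_add_le _ _).trans ?_
    rw [abs_mul, abs_of_pos hγ0]
  have h4 : |(M *ᵥ v) t| ≤ |v t| := abs_le.2 ⟨by linarith, h1⟩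
  have h5 := mul_le_mul_of_nonneg_left h4 hγ0.le
  linarith [hr t]

theorem bOp_le_sup' [Fintype S] [Fintype A] [DecidableEq S]
    [Nonempty A] (γ : ℝ) (r : S → ℝ) (π : S → A) (v : S → ℝ) (s : S) :
    bOp P γ r π v s
      ≤ Finset.univ.sup' Finset.univ_nonempty fun π' : S → A => bOp P γ r π' v s :=
  le_sup' (fun π' : S → A => bOp P γ r π' v s) (mem_univ π)

theorem errOf_nonneg [Fintype S] [Fintype A] [DecidableEq S]
    [Nonempty A] (γ : ℝ) (r : S → ℝ) (v : S → ℝ) (π : S → A) :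
    0 ≤ errOf P γ r v π :=
  fun s => sub_nonneg.2 (bOp_le_sup' γ r π v s)

/-- One step of conservative policy iteration: the new loss is bounded by the contracted old
loss plus a residual `z` that solves the Bellman-type inequality driven by the error. -/
theorem exists_residual_of_mixPol [Fintype S] [Fintype A] [DecidableEq S] [DecidableEq A]
    [Nonempty A] (hP0 : ∀ s a s', 0 ≤ P s a s')
    (hP1 : ∀ s a, ∑ s' : S, P s a s' = 1) {γ : ℝ} (hγ0 : 0 < γ) {r : S → ℝ}
    {α : ℝ} (hα0 : 0 < α) (hα1 : α ≤ 1) {π : S → A → ℝ} (hπ : isStoch π) {π' πstar : S → A}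
    {v v' vstar : S → ℝ} (hv : bOpS P γ r π v = v)
    (hv' : bOpS P γ r (mixPol α π (detPol π')) v' = v') (hstar : bOp P γ r πstar vstar = vstar) :
    ∃ z : S → ℝ,
      z ≤ α • errOf P γ r v π' + γ • (polMatS P (mixPol α π (detPol π')) *ᵥ z) ∧
      vstar - v' ≤ (1 - α) • (vstar - v) + (α * γ) • (polMat P πstar *ᵥ (vstar - v)) + z := by
  set R := polMatS P (mixPol α π (detPol π')) with hR
  have hRs : R ∈ rowStochastic ℝ S :=
    polMatS_mem_rowStochastic hP0 hP1 (hπ.mixPol hα0.le hα1 (isStoch_detPol π'))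
  set g : S → ℝ := fun s =>
    (Finset.univ.sup' Finset.univ_nonempty fun π' : S → A => bOp P γ r π' v s) - v s with hg
  have hg0 : 0 ≤ g := by
    obtain ⟨π₁, hπ₁⟩ := exists_polMatS_mulVec_le (P := P) hπ v
    intro s
    have h1 := bOp_le_sup' (P := P) γ r π₁ v s
    have h2 := congrFun hv s
    rw [bOpS_apply] at h2
    rw [bOp_apply] at h1
    have h3 := mul_le_mul_of_nonneg_left (hπ₁ s) hγ0.le
    simp only [hg, Pi.zero_apply]
    linarith
  have hRv : ∀ s, (R *ᵥ v) s = (1 - α) * (polMatS P π *ᵥ v) s + α * (polMat P π' *ᵥ v) s := by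
    intro s
    rw [hR, polMatS_mixPol, polMatS_detPol]
    simp [add_mulVec, smul_mulVec]
  refine ⟨α • g - (v' - v), fun s => ?_, fun s => ?_⟩
  · have h1 := congrFun hv s
    have h2 := congrFun hv' s
    rw [bOpS_apply] at h1 h2
    have h3 := nonneg_mulVec_of_mem_rowStochastic hRs hg0 s
    have h4 : 0 ≤ γ * (α * (R *ᵥ g) s) := by positivity
    have h5 := hRv s
    simp only [mulVec_sub, mulVec_smul, Pi.add_apply, Pi.sub_apply, Pi.smul_apply, smul_eq_mul,
      errOf, bOp_apply, hg] at *
    rw [← hR] at h2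
    nlinarith
  · have h1 := bOp_le_sup' (P := P) γ r πstar v s
    have h2 := congrFun hstar s
    rw [bOp_apply] at h1 h2
    have h3 := mul_le_mul_of_nonneg_left h1 hα0.le
    simp only [mulVec_sub, Pi.add_apply, Pi.sub_apply, Pi.smul_apply, smul_eq_mul, hg]
    linear_combination h3 - α * h2

end

/-- API(α): for a CPI-type sequence with constant step `α ∈ (0,1]` whose
errors are controlled directly by `ν`: `ν e_i ≤ ε` for all `i ≥ 1`, with `ε ∈ (0, 2Vmax]`
and `C^{(1,0)} = (1−γ)Σ_l γ^l c(l) < ∞`: if `k = ⌈log(2Vmax/ε)/(α(1−γ))⌉` then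
`μ(v_{π*} − v_{π_k}) ≤ (αk C^{(1,0)}/(1−γ) + 1) ε
≤ (C^{(1,0)}(log(2Vmax/ε)/(1−γ) + 1)/(1−γ) + 1) ε`. -/
theorem stmt15
    {S A : Type*} [Fintype S] [Fintype A] [DecidableEq S] [DecidableEq A]
    [Nonempty S] [Nonempty A]
    (P : S → A → S → ℝ) (hP0 : ∀ s a s', 0 ≤ P s a s')
    (hP1 : ∀ s a, ∑ s' : S, P s a s' = 1)
    (γ : ℝ) (hγ0 : 0 < γ) (hγ1 : γ < 1)
    (Rmax Vmax : ℝ) (r : S → ℝ) (hr : ∀ s, |r s| ≤ Rmax)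
    (hVmax : Vmax = Rmax / (1 - γ))
    (πstar : S → A) (vstar : S → ℝ)
    (hfix : bOp P γ r πstar vstar = vstar)
    (hopt : ∀ (π : S → A) (v : S → ℝ), bOp P γ r π v = v → ∀ s, v s ≤ vstar s)
    (μ ν : S → ℝ) (hμ0 : ∀ s, 0 ≤ μ s) (hμ1 : ∑ s : S, μ s = 1)
    (hν0 : ∀ s, 0 ≤ ν s) (hν1 : ∑ s : S, ν s = 1)
    (c : ℕ → ℝ) (hc0 : ∀ i, 0 ≤ c i)
    (hc : ∀ (i : ℕ) (πs : ℕ → S → A) (s : S),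
      Matrix.vecMul μ (((List.range i).map fun t => polMat P (πs t)).prod) s ≤ c i * ν s)
    (hsum : Summable fun l : ℕ => γ ^ l * c l)
    (π0 : S → A → ℝ) (hπ0 : isStoch π0)
    (α : ℝ) (hα0 : 0 < α) (hα1 : α ≤ 1)
    (π'f : ℕ → S → A)
    (vS : ℕ → S → ℝ)
    (hvS : ∀ i : ℕ, bOpS P γ r (cpiSeq π0 (fun _ => α) π'f i) (vS i) = vS i)
    (ε : ℝ) (hε0 : 0 < ε) (hε1 : ε ≤ 2 * Vmax)
    (herr : ∀ i, 1 ≤ i →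
      (∑ s : S, ν s * errOf P γ r (vS (i - 1)) (π'f i) s) ≤ ε)
    (k : ℕ) (hk : k = ⌈Real.log (2 * Vmax / ε) / (α * (1 - γ))⌉₊) :
    (∑ s : S, μ s * (vstar s - vS k s)) ≤
        (α * k * ((1 - γ) * ∑' l : ℕ, γ ^ l * c l) / (1 - γ) + 1) * ε
    ∧ (α * k * ((1 - γ) * ∑' l : ℕ, γ ^ l * c l) / (1 - γ) + 1) * ε ≤
        (((1 - γ) * ∑' l : ℕ, γ ^ l * c l)
            * (Real.log (2 * Vmax / ε) / (1 - γ) + 1) / (1 - γ) + 1) * ε := by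
  have h1γ : 0 < 1 - γ := sub_pos.2 hγ1
  set K := ∑' l : ℕ, γ ^ l * c l with hK
  have hK0 : 0 ≤ K := tsum_nonneg fun l => mul_nonneg (pow_pos hγ0 l).le (hc0 l)
  have hV : 0 < 2 * Vmax := hε0.trans_le hε1
  have hlog : 0 ≤ Real.log (2 * Vmax / ε) :=
    Real.log_nonneg ((one_le_div hε0).2 hε1)
  set L := Real.log (2 * Vmax / ε) with hL
  have hKC : ∀ x : ℝ, x * ((1 - γ) * K) / (1 - γ) = x * K := fun x => by
    field_simp
  have hKC' : ∀ x : ℝ, (1 - γ) * K * x / (1 - γ) = x * K := fun x => by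
    field_simp
  rw [hKC, hKC']
  have hαγ : 0 < α * (1 - γ) := mul_pos hα0 h1γ
  constructor
  · have hstoch := isStoch_cpiSeq hπ0 hα0.le hα1 π'f
    set Q := polMat P πstar with hQ
    have hQs : Q ∈ rowStochastic ℝ S := polMat_mem_rowStochastic hP0 hP1 πstar
    have hvstar := abs_le_of_eq_add_mul_mulVec hγ0 hγ1 hr hQs (congrFun hfix)
    have hv0 := abs_le_of_eq_add_mul_mulVec hγ0 hγ1 hr
      (polMatS_mem_rowStochastic hP0 hP1 (hstoch 0)) (congrFun (hvS 0))
    have hmain : ∀ i j : ℕ, γ ^ j * (μ ⬝ᵥ (Q ^ j *ᵥ (vstar - vS i)))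
        ≤ α * i * K * ε + γ ^ j * ((1 - α * (1 - γ)) ^ i * (2 * Vmax)) := by
      intro i
      induction i with
      | zero =>
        intro j
        have := dotProduct_le_of_sum_eq_one hμ0 hμ1 fun s =>
          mulVec_le_of_mem_rowStochastic (pow_mem hQs j) (f := vstar - vS 0) (W := 2 * Vmax)
            (fun s => by
              have h1 := (abs_le.1 (hvstar s)).2
              have h2 := (abs_le.1 (hv0 s)).1
              rw [← hVmax] at h1 h2
              rw [Pi.sub_apply]
              linarith) s
        simpa using mul_le_mul_of_nonneg_left this (pow_pos hγ0 j).le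
      | succ i ih =>
        intro j
        obtain ⟨z, hz, hstep⟩ := exists_residual_of_mixPol hP0 hP1 hγ0 hα0 hα1 (hstoch i)
          (hvS i) (hvS (i + 1)) hfix
        set e := errOf P γ r (vS i) (π'f (i + 1)) with he
        have he0 : 0 ≤ e := errOf_nonneg γ r _ _
        have heε : ν ⬝ᵥ e ≤ ε := herr (i + 1) (Nat.le_add_left 1 i)
        change z ≤ α • e + γ • (polMatS P (cpiSeq π0 (fun _ => α) π'f (i + 1)) *ᵥ z) at hz
        have hRst := hstoch (i + 1)
        set R := polMatS P (cpiSeq π0 (fun _ => α) π'f (i + 1)) with hR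
        have hRs : R ∈ rowStochastic ℝ S := polMatS_mem_rowStochastic hP0 hP1 hRst
        have hz_le : γ ^ j * (μ ⬝ᵥ (Q ^ j *ᵥ z)) ≤ K * (α * ε) := by
          obtain ⟨t, ht⟩ := Finite.exists_max z
          have := pow_mul_le_tsum_mul_of_le_add_mul (B := α * ε) (W := z t) hγ0 hγ1 hc0 hsum j
            (x := fun n => μ ⬝ᵥ (Q ^ j *ᵥ (R ^ n *ᵥ z)))
            (b := fun n => α * (μ ⬝ᵥ (Q ^ j *ᵥ (R ^ n *ᵥ e))))
            (mul_pos hα0 hε0).le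
            (fun l => by
              have hdom := ((dominatedBy_zero (P := P) e).polMatS_pow_mulVec hP0 hP1 hRst
                l).polMatS_pow_mulVec hP0 hP1 (isStoch_detPol πstar) j
              rw [polMatS_detPol, Nat.add_zero] at hdom
              have h1 := hdom.dotProduct_le hμ0 hc he0
              have h2 := mul_le_mul_of_nonneg_left heε (hc0 (j + l))
              have h3 := mul_le_mul_of_nonneg_left (h1.trans h2) hα0.le
              linarith)
            (fun n => by
              have h1 := dotProduct_le_dotProduct_of_nonneg_left
                (mulVec_le_mulVec_of_nonneg (pow_mem hQs j).1
                  (mulVec_le_mulVec_of_nonneg (pow_mem hRs n).1 hz)) hμ0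
              simpa [mulVec_add, mulVec_smul, pow_succ, dotProduct_add, mulVec_mulVec]
                using h1)
            (fun n => dotProduct_le_of_sum_eq_one hμ0 hμ1 <|
              mulVec_le_of_mem_rowStochastic (pow_mem hQs j) <|
                mulVec_le_of_mem_rowStochastic (pow_mem hRs n) ht)
          simpa using this
        have hQstep := dotProduct_le_dotProduct_of_nonneg_left
          (mulVec_le_mulVec_of_nonneg (pow_mem hQs j).1 hstep) hμ0
        rw [mulVec_add, mulVec_add, mulVec_smul, mulVec_smul, mulVec_mulVec, ← pow_succ,
          dotProduct_add, dotProduct_add, dotProduct_smul, dotProduct_smul, smul_eq_mul,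
          smul_eq_mul] at hQstep
        have h1 := mul_le_mul_of_nonneg_left hQstep (pow_pos hγ0 j).le
        have h2 := mul_le_mul_of_nonneg_left (ih j) (sub_nonneg.2 hα1)
        have h3 := mul_le_mul_of_nonneg_left (ih (j + 1)) hα0.le
        rw [pow_succ γ j] at h3
        push_cast
        rw [pow_succ (1 - α * (1 - γ)) i]
        linarith
    have hgeom : (1 - α * (1 - γ)) ^ k * (2 * Vmax) ≤ ε := by
      have h0 : 0 ≤ 1 - α * (1 - γ) := by nlinarith
      have h1 : (1 - α * (1 - γ)) ^ k ≤ Real.exp (-(α * (1 - γ))) ^ k :=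
        pow_le_pow_left₀ h0 (Real.one_sub_le_exp_neg _) k
      have h2 : L ≤ k * (α * (1 - γ)) := by
        rw [← div_le_iff₀ hαγ, hk]
        exact Nat.le_ceil _
      have h3 : Real.exp (-(α * (1 - γ))) ^ k ≤ ε / (2 * Vmax) := by
        rw [← Real.exp_nat_mul]
        calc Real.exp (k * -(α * (1 - γ))) ≤ Real.exp (-L) := Real.exp_le_exp.2 (by linarith)
          _ = ε / (2 * Vmax) := by
            rw [Real.exp_neg, hL, Real.exp_log (div_pos hV hε0), inv_div]
      exact (le_div_iff₀ hV).1 (h1.trans h3)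
    have := hmain k 0
    simp only [pow_zero, one_mul, one_mulVec] at this
    change μ ⬝ᵥ (vstar - vS k) ≤ _
    linarith
  · have hαk : α * k ≤ L / (1 - γ) + 1 := by
      have h1 : (k : ℝ) ≤ L / (α * (1 - γ)) + 1 := by
        rw [hk]
        exact (Nat.ceil_lt_add_one (div_nonneg hlog hαγ.le)).le
      have h2 := mul_le_mul_of_nonneg_left h1 hα0.le
      have h3 : α * (L / (α * (1 - γ)) + 1) = L / (1 - γ) + α := by
        field_simp
      linarith
    gcongr
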